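/- For n ≥ 1 let E_n = ( Σ_{k=2}^{n+1} k·A_{n,k} ) / A_n and V_n = ( Σ_{k=2}^{n+1} k²·A_{n,k} ) / A_n − E_n², the variance of the number of vertices of a uniformly random rooted plane multi-edge tree with n edges. Then V_n = (4/25)·n + 2/25 + O(1/n) as n → ∞. -/

import Mathlib

open Filter Asymptotics

/-- `A_{n,k} = (1/k)·C(2k−2,k−1)·C(n−1,k−2)`, the number of rooted plane multi-edge
trees with `n` edges and `k` vertices. -/
noncomputable def Ank (n k : ℕ) : ℚ :=
  (1 / k : ℚ) * Nat.choose (2 * k - 2) (k - 1) * Nat.choose (n - 1) (k - 2)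

/-- `A_n = Σ_{k=2}^{n+1} A_{n,k}`, the number of rooted plane multi-edge trees
with `n` edges. -/
noncomputable def A (n : ℕ) : ℚ := ∑ k ∈ Finset.Icc 2 (n + 1), Ank n k

/-- `E_n`, the expected number of vertices of a uniformly random rooted plane
multi-edge tree with `n` edges. -/
noncomputable def Evert (n : ℕ) : ℚ := (∑ k ∈ Finset.Icc 2 (n + 1), (k : ℚ) * Ank n k) / A n

/-- `V_n`, the variance of the number of vertices of a uniformly random rooted plane
multi-edge tree with `n` edges. -/
noncomputable def Vvert (n : ℕ) : ℚ :=
  (∑ k ∈ Finset.Icc 2 (n + 1), (k : ℚ) ^ 2 * Ank n k) / A n - (Evert n) ^ 2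

/-- The binomial transform of a sequence. -/
noncomputable def binomTransform (c : ℕ → ℚ) (N : ℕ) : ℚ :=
  ∑ j ∈ Finset.range (N + 1), (N.choose j : ℚ) * c j

lemma binomTransform_add (c d : ℕ → ℚ) (N : ℕ) :
    binomTransform (fun j => c j + d j) N = binomTransform c N + binomTransform d N := by
  simp [binomTransform, mul_add, Finset.sum_add_distrib]

lemma binomTransform_const_mul (a : ℚ) (c : ℕ → ℚ) (N : ℕ) :
    binomTransform (fun j => a * c j) N = a * binomTransform c N := by
  simp only [binomTransform, Finset.mul_sum]
  exact Finset.sum_congr rfl fun j _ => by ring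

lemma binomTransform_succ (c : ℕ → ℚ) (N : ℕ) :
    binomTransform c (N + 1) = binomTransform c N + binomTransform (fun j => c (j + 1)) N := by
  have h : binomTransform c N = ∑ j ∈ Finset.range (N + 2), (N.choose j : ℚ) * c j := by
    simp [Finset.sum_range_succ _ (N + 1), binomTransform]
  rw [h, binomTransform, Finset.sum_range_succ', Finset.sum_range_succ' _ (N + 1),
    binomTransform]
  simp only [Nat.choose_succ_succ, Nat.cast_add, add_mul, Finset.sum_add_distrib,
    Nat.choose_zero_right]
  ring

lemma binomTransform_shift (c : ℕ → ℚ) (N : ℕ) :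
    binomTransform (fun j => c (j + 1)) N = binomTransform c (N + 1) - binomTransform c N := by
  rw [binomTransform_succ]
  ring

lemma binomTransform_index_mul (c : ℕ → ℚ) (N : ℕ) :
    binomTransform (fun j => (j : ℚ) * c j) (N + 1)
      = (N + 1) * (binomTransform c (N + 1) - binomTransform c N) := by
  rw [← binomTransform_shift, binomTransform, Finset.sum_range_succ', binomTransform,
    Finset.mul_sum]
  simp only [Nat.cast_zero, zero_mul, mul_zero, add_zero]
  refine Finset.sum_congr rfl fun j _ => ?_
  have h : ((N + 1 : ℕ) : ℚ) * N.choose j = (N + 1).choose (j + 1) * (j + 1 : ℕ) := by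
    exact_mod_cast Nat.add_one_mul_choose_eq N j
  push_cast at h ⊢
  linear_combination -c (j + 1) * h

/-- The Catalan number of index `j + 1`, as a rational number. -/
noncomputable def catalanSucc (j : ℕ) : ℚ := (Nat.centralBinom (j + 1) : ℚ) / (j + 2)

lemma catalanSucc_pos (j : ℕ) : 0 < catalanSucc j := by
  have : (0 : ℚ) < Nat.centralBinom (j + 1) := by exact_mod_cast Nat.centralBinom_pos _
  unfold catalanSucc
  positivity

lemma catalanSucc_succ (j : ℕ) :
    (j + 3 : ℚ) * catalanSucc (j + 1) = (4 * j + 6) * catalanSucc j := by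
  have h : ((j + 1 + 1 : ℕ) : ℚ) * Nat.centralBinom (j + 1 + 1)
      = (2 * (2 * (j + 1) + 1) : ℕ) * Nat.centralBinom (j + 1) := by
    exact_mod_cast Nat.succ_mul_centralBinom_succ (j + 1)
  push_cast at h
  have h2 : (j + 2 : ℚ) ≠ 0 := by positivity
  have h3 : (j + 1 + 2 : ℚ) ≠ 0 := by positivity
  unfold catalanSucc
  push_cast
  field_simp
  linear_combination (j + 3 : ℚ) * h

/-- The number of rooted plane multi-edge trees with `N + 1` edges. -/
noncomputable def treeCount (N : ℕ) : ℚ := binomTransform catalanSucc N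

lemma treeCount_pos (N : ℕ) : 0 < treeCount N := by
  refine Finset.sum_pos (fun j hj => ?_) Finset.nonempty_range_add_one
  have : 0 < N.choose j := Nat.choose_pos (Nat.lt_succ_iff.mp (Finset.mem_range.mp hj))
  have := catalanSucc_pos j
  positivity

lemma treeCount_recurrence (N : ℕ) :
    (N + 4 : ℚ) * treeCount (N + 2)
      = (6 * N + 15) * treeCount (N + 1) - 5 * (N + 1) * treeCount N := by
  have h : binomTransform (fun j => (j : ℚ) * catalanSucc (j + 1) + 3 * catalanSucc (j + 1))
      (N + 1) = binomTransform (fun j => 4 * (j * catalanSucc j) + 6 * catalanSucc j)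
      (N + 1) := by
    congr 1
    funext j
    linear_combination catalanSucc_succ j
  rw [binomTransform_add, binomTransform_add, binomTransform_const_mul,
    binomTransform_const_mul, binomTransform_const_mul, binomTransform_index_mul,
    binomTransform_index_mul _ N, binomTransform_shift, binomTransform_shift] at h
  unfold treeCount
  linear_combination h

lemma sum_mul_Ank (f : ℕ → ℚ) (N : ℕ) :
    ∑ k ∈ Finset.Icc 2 (N + 1 + 1), f k * Ank (N + 1) k
      = binomTransform (fun j => f (j + 2) * catalanSucc j) N := by
  rw [← Finset.Ico_add_one_right_eq_Icc, Finset.sum_Ico_eq_sum_range, binomTransform,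
    show N + 1 + 1 + 1 - 2 = N + 1 by omega]
  refine Finset.sum_congr rfl fun j _ => ?_
  rw [Ank, catalanSucc, Nat.centralBinom, add_comm 2 j,
    show 2 * (j + 2) - 2 = 2 * (j + 1) by omega, show j + 2 - 1 = j + 1 by omega,
    show j + 2 - 2 = j by omega, show N + 1 - 1 = N by omega]
  push_cast
  ring

lemma A_eq_treeCount (N : ℕ) : A (N + 1) = treeCount N := by
  simpa [A, treeCount] using sum_mul_Ank (fun _ => 1) N

lemma sum_vertices_eq (N : ℕ) :
    ∑ k ∈ Finset.Icc 2 (N + 1 + 1 + 1), (k : ℚ) * Ank (N + 1 + 1) k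
      = (N + 1) * (treeCount (N + 1) - treeCount N) + 2 * treeCount (N + 1) := by
  rw [sum_mul_Ank (fun k => (k : ℚ)), treeCount, treeCount, ← binomTransform_index_mul,
    ← binomTransform_const_mul, ← binomTransform_add]
  congr 1
  funext j
  push_cast
  ring

lemma sum_vertices_sq_eq (N : ℕ) :
    ∑ k ∈ Finset.Icc 2 (N + 2 + 1 + 1), (k : ℚ) ^ 2 * Ank (N + 2 + 1) k
      = (N + 2) * (N + 1) * (treeCount (N + 2) - 2 * treeCount (N + 1) + treeCount N)
        + 5 * (N + 2) * (treeCount (N + 2) - treeCount (N + 1)) + 4 * treeCount (N + 2) := by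
  have h : (fun j : ℕ => ((j + 2 : ℕ) : ℚ) ^ 2 * catalanSucc j)
      = fun j : ℕ => (j : ℚ) * (j * catalanSucc j) + (4 * (j * catalanSucc j) + 4 * catalanSucc j) := by
    funext j
    push_cast
    ring
  rw [sum_mul_Ank (fun k => (k : ℚ) ^ 2), h, binomTransform_add, binomTransform_add,
    binomTransform_const_mul, binomTransform_const_mul, binomTransform_index_mul,
    binomTransform_index_mul, binomTransform_index_mul]
  unfold treeCount
  push_cast
  ring

/-- The variance as a quadratic polynomial in the ratio of consecutive tree counts. -/
lemma Vvert_eq (N : ℕ) :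
    Vvert (N + 3) = (N + 2) ^ 2 * (-(1 / 5) + 6 / 5 * (treeCount (N + 1) / treeCount (N + 2))
        - (treeCount (N + 1) / treeCount (N + 2)) ^ 2)
      + (N + 2) * (-(2 / 5) + 8 / 5 * (treeCount (N + 1) / treeCount (N + 2))) := by
  have h0 := (treeCount_pos (N + 2)).ne'
  have h1 := sum_vertices_eq (N + 1)
  have h2 := sum_vertices_sq_eq N
  have h3 := A_eq_treeCount (N + 2)
  have h4 := treeCount_recurrence N
  rw [Vvert, Evert, h3, h1, h2]
  push_cast
  field_simp
  linear_combination ((N + 2) * treeCount (N + 2) : ℚ) * h4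

/-- The ratio of consecutive tree counts, to third order in `1 / (N + 2)`. -/
lemma treeCount_ratio_bounds (N : ℕ) :
    1 / 5 + 3 / (10 * (N + 2 : ℚ)) - 3 / (16 * (N + 2 : ℚ) ^ 2) - 1 / (N + 2 : ℚ) ^ 3
        ≤ treeCount (N + 1) / treeCount (N + 2) ∧
      treeCount (N + 1) / treeCount (N + 2)
        ≤ 1 / 5 + 3 / (10 * (N + 2 : ℚ)) - 3 / (16 * (N + 2 : ℚ) ^ 2) + 1 / (N + 2 : ℚ) ^ 3 := by
  induction N with
  | zero =>
    have h1 : treeCount 1 = 3 := by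
      norm_num [treeCount, binomTransform, catalanSucc, Finset.sum_range_succ, Nat.centralBinom,
        Nat.choose]
    have h2 : treeCount 2 = 10 := by
      norm_num [treeCount, binomTransform, catalanSucc, Finset.sum_range_succ, Nat.centralBinom,
        Nat.choose]
    norm_num [h1, h2]
  | succ N ih =>
    obtain ⟨hl, hu⟩ := ih
    have p2 := treeCount_pos (N + 2)
    have p3 := treeCount_pos (N + 3)
    have hrec := treeCount_recurrence (N + 1)
    have hN : (0 : ℚ) ≤ N := N.cast_nonneg
    push_cast at hrec ⊢
    set x := treeCount (N + 1) / treeCount (N + 2) with hx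
    set y := treeCount (N + 1 + 1) / treeCount (N + 1 + 2) with hy
    have hxy : (N + 5 : ℚ) = y * ((6 * N + 21) - 5 * (N + 2) * x) := by
      rw [hx, hy]
      field_simp
      linear_combination hrec
    have hypos : 0 < y := div_pos p2 p3
    generalize (N : ℚ) = m at *
    have hz : 0 < 6 * m + 21 - 5 * (m + 2) * x := by
      by_contra! hneg
      nlinarith
    have hyx : y = (m + 5) / (6 * m + 21 - 5 * (m + 2) * x) := by
      rw [eq_div_iff hz.ne']
      linarith
    have el : 5 * (m + 2) * (1 / 5 + 3 / (10 * (m + 2)) - 3 / (16 * (m + 2) ^ 2)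
        - 1 / (m + 2) ^ 3) = m + 2 + 3 / 2 - 15 / (16 * (m + 2)) - 5 / (m + 2) ^ 2 := by
      field_simp
      ring
    have eu : 5 * (m + 2) * (1 / 5 + 3 / (10 * (m + 2)) - 3 / (16 * (m + 2) ^ 2)
        + 1 / (m + 2) ^ 3) = m + 2 + 3 / 2 - 15 / (16 * (m + 2)) + 5 / (m + 2) ^ 2 := by
      field_simp
      ring
    have hl' := mul_le_mul_of_nonneg_left hl (show 0 ≤ 5 * (m + 2) by positivity)
    have hu' := mul_le_mul_of_nonneg_left hu (show 0 ≤ 5 * (m + 2) by positivity)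
    rw [el] at hl'
    rw [eu] at hu'
    have hd : 0 < 6 * m + 21 - (m + 2 + 3 / 2 - 15 / (16 * (m + 2)) + 5 / (m + 2) ^ 2) := by
      have : 5 / (m + 2) ^ 2 ≤ 5 := div_le_self (by norm_num) (by nlinarith)
      have : 0 ≤ 15 / (16 * (m + 2)) := by positivity
      linarith
    constructor
    · calc _ ≤ (m + 5) / (6 * m + 21
            - (m + 2 + 3 / 2 - 15 / (16 * (m + 2)) - 5 / (m + 2) ^ 2)) := by
            rw [le_div_iff₀ (by linarith), ← sub_nonneg]
            field_simp
            ring_nf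
            positivity
        _ ≤ y := by
            rw [hyx]
            gcongr
    · calc y ≤ (m + 5) / (6 * m + 21
            - (m + 2 + 3 / 2 - 15 / (16 * (m + 2)) + 5 / (m + 2) ^ 2)) := by
            rw [hyx]
            gcongr
        _ ≤ _ := by
            rw [div_le_iff₀ hd, ← sub_nonneg]
            field_simp
            ring_nf
            positivity

lemma abs_Vvert_sub_le (N : ℕ) :
    |Vvert (N + 3) - (4 / 25 * (N + 3) + 2 / 25)| ≤ 7 / (N + 2) := by
  obtain ⟨hl, hu⟩ := treeCount_ratio_bounds N
  rw [Vvert_eq]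
  set x := treeCount (N + 1) / treeCount (N + 2)
  have hN : (0 : ℚ) ≤ N := N.cast_nonneg
  generalize (N : ℚ) = m at *
  obtain ⟨t, ht⟩ : ∃ t, t = (m + 2) ^ 3 * (x - (1 / 5 + 3 / (10 * (m + 2))
      - 3 / (16 * (m + 2) ^ 2))) := ⟨_, rfl⟩
  obtain ⟨u, hu_def⟩ : ∃ u, u = 1 / (m + 2) := ⟨_, rfl⟩
  have hm : 0 < m + 2 := by positivity
  have hx : x = 1 / 5 + 3 / (10 * (m + 2)) - 3 / (16 * (m + 2) ^ 2) + t / (m + 2) ^ 3 := by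
    rw [ht]
    field_simp
    ring
  have ht1 : |t| ≤ 1 := by
    rw [hx] at hl hu
    rw [abs_le]
    constructor
    · have : -1 / (m + 2) ^ 3 ≤ t / (m + 2) ^ 3 := by
        rw [neg_div]
        linarith
      exact (div_le_div_iff_of_pos_right (by positivity)).mp this
    · have : t / (m + 2) ^ 3 ≤ 1 / (m + 2) ^ 3 := by linarith
      exact (div_le_div_iff_of_pos_right (by positivity)).mp this
  have hu0 : 0 < u := by
    rw [hu_def]
    positivity
  have hu1 : u ≤ 1 := by
    rw [hu_def, div_le_one hm]
    linarith
  obtain ⟨s, hs⟩ : ∃ s, s = -(3 / 16) + t * u := ⟨_, rfl⟩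
  have hkey : (m + 2) ^ 2 * (-(1 / 5) + 6 / 5 * x - x ^ 2) + (m + 2) * (-(2 / 5) + 8 / 5 * x)
      - (4 / 25 * (m + 3) + 2 / 25) = u * (4 / 5 * t + s - u * s ^ 2) := by
    rw [hs, hu_def, hx]
    field_simp
    ring
  obtain ⟨ht2, ht3⟩ := abs_le.mp ht1
  have hs1 : -2 ≤ s := by nlinarith
  have hs2 : s ≤ 2 := by nlinarith
  have hs3 : s ^ 2 ≤ 4 := by nlinarith
  have hs4 : u * s ^ 2 ≤ 4 := by nlinarith [sq_nonneg s]
  have hs5 : 0 ≤ u * s ^ 2 := by positivity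
  have hb : |4 / 5 * t + s - u * s ^ 2| ≤ 7 := by
    rw [abs_le]
    constructor <;> linarith
  rw [hkey, abs_mul, abs_of_pos hu0, show 7 / (m + 2) = u * 7 by rw [hu_def]; ring]
  gcongr

/-- `V_n = (4/25)n + 2/25 + O(1/n)` as `n → ∞`. -/
theorem variance_vertices :
    (fun n : ℕ => (Vvert n : ℝ) - ((4 / 25) * (n : ℝ) + 2 / 25))
      =O[atTop] (fun n : ℕ => 1 / (n : ℝ)) := by
  refine IsBigO.of_bound 21 (eventually_atTop.mpr ⟨3, fun n hn => ?_⟩)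
  obtain ⟨N, rfl⟩ := Nat.exists_eq_add_of_le' hn
  have h : |(Vvert (N + 3) : ℝ) - (4 / 25 * ((N : ℝ) + 3) + 2 / 25)| ≤ 7 / ((N : ℝ) + 2) := by
    have := Rat.cast_le (K := ℝ).mpr (abs_Vvert_sub_le N)
    push_cast at this
    exact this
  have hN : (0 : ℝ) ≤ N := N.cast_nonneg
  rw [Real.norm_eq_abs, Real.norm_eq_abs,
    abs_of_nonneg (show (0 : ℝ) ≤ 1 / ((N + 3 : ℕ) : ℝ) by positivity)]
  push_cast
  refine h.trans ?_
  rw [mul_one_div, div_le_div_iff₀ (by positivity) (by positivity)]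
  linarith
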